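/- Let p be a prime, s ≥ 1 an integer, and let t_1 < t_2 < … < t_{2^s} be pairwise coprime integers with t_1 ≥ 5. Set q = p^{t_1 t_2 ⋯ t_{2^s}}. Then there exists a 2-dimensional Reed–Solomon code over F_q of length n = 2^s p^{t_1 − 2} whose minimum insdel distance d satisfies d ≥ 2n − 2( n/2^s + Σ_{i=0}^{s−1} ( 2^i(2^i − 1)p + 2^i ) ). -/

import Mathlib

open Pointwise Function

/-- `b` is obtained from `a` by a single symbol insertion or deletion. -/
def InsDelStep {α : Type*} (a b : List α) : Prop :=
  (∃ (l r : List α) (x : α), a = l ++ x :: r ∧ b = l ++ r) ∨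
  (∃ (l r : List α) (x : α), b = l ++ x :: r ∧ a = l ++ r)

/-- The insdel distance: the minimum number of single-symbol insertions and
deletions needed to transform `a` into `b`. -/
noncomputable def insdelDist {α : Type*} (a b : List α) : ℕ :=
  sInf {m : ℕ | ∃ c : ℕ → List α, c 0 = a ∧ c m = b ∧ ∀ i < m, InsDelStep (c i) (c (i + 1))}

/-- The minimum insdel distance of a code `C ⊆ F^n`. -/
noncomputable def codeInsdelDist {F : Type*} {n : ℕ} (C : Set (Fin n → F)) : ℕ :=
  sInf {m : ℕ | ∃ c1 ∈ C, ∃ c2 ∈ C, c1 ≠ c2 ∧ m = insdelDist (List.ofFn c1) (List.ofFn c2)}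

theorem InsDelStep.symm {α : Type*} {a b : List α} (h : InsDelStep a b) : InsDelStep b a :=
  Or.symm h

theorem exists_insDelStep_chain_of_reflTransGen {α : Type*} {a b : List α}
    (h : Relation.ReflTransGen InsDelStep a b) :
    ∃ m, ∃ c : ℕ → List α, c 0 = a ∧ c m = b ∧ ∀ i < m, InsDelStep (c i) (c (i + 1)) := by
  induction h with
  | refl => exact ⟨0, fun _ => a, rfl, rfl, by simp⟩
  | @tail b d _ hbd ih =>
    obtain ⟨m, c, h0, hm, hc⟩ := ih
    refine ⟨m + 1, fun i => if i ≤ m then c i else d, by simpa using h0, by simp, ?_⟩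
    intro i hi
    rcases Nat.lt_succ_iff_lt_or_eq.1 hi with hi | rfl
    · simpa [hi.le, Nat.succ_le_of_lt hi] using hc i hi
    · simpa [hm] using hbd

theorem reflTransGen_insDelStep {α : Type*} (a b : List α) :
    Relation.ReflTransGen InsDelStep a b := by
  have hnil : ∀ l : List α, Relation.ReflTransGen InsDelStep l [] := by
    intro l
    induction l with
    | nil => exact .refl
    | cons x l ih => exact .head (Or.inl ⟨[], l, x, rfl, rfl⟩) ih
  have : Std.Symm (InsDelStep (α := α)) := ⟨fun _ _ h => h.symm⟩
  exact (hnil a).trans (Relation.ReflTransGen.stdSymm.symm _ _ (hnil b))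

theorem exists_common_sublist_of_insDelStep_chain {α : Type*} (c : ℕ → List α) (m : ℕ)
    (hc : ∀ i < m, InsDelStep (c i) (c (i + 1))) :
    ∃ w : List α, w.Sublist (c 0) ∧ w.Sublist (c m) ∧
      (c 0).length + (c m).length ≤ m + 2 * w.length := by
  induction m with
  | zero => exact ⟨c 0, .refl _, .refl _, by omega⟩
  | succ m ih =>
    obtain ⟨w, hw0, hwm, hlen⟩ := ih fun i hi => hc i (by omega)
    rcases hc m (by omega) with ⟨l, r, x, ha, hb⟩ | ⟨l, r, x, hb, ha⟩
    · rw [ha] at hwm hlen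
      rw [hb]
      obtain ⟨w₁, w₂, rfl, h₁, h₂⟩ := List.sublist_append_iff.1 hwm
      cases h₂ with
      | cons _ h₂ =>
        refine ⟨w₁ ++ w₂, hw0, h₁.append h₂, ?_⟩
        simp only [List.length_append, List.length_cons] at hlen ⊢
        omega
      | @cons_cons w₃ _ _ h₂ =>
        refine ⟨w₁ ++ w₃, .trans (.append (.refl _) (List.sublist_cons_self _ _)) hw0,
          h₁.append h₂, ?_⟩
        simp only [List.length_append, List.length_cons] at hlen ⊢
        omega
    · rw [ha] at hwm hlen
      refine ⟨w, hw0, ?_, ?_⟩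
      · rw [hb]
        exact hwm.trans (.append (.refl _) (List.sublist_cons_self _ _))
      · rw [hb]
        simp only [List.length_append, List.length_cons] at hlen ⊢
        omega

theorem exists_common_sublist_insdelDist {α : Type*} (a b : List α) :
    ∃ w : List α, w.Sublist a ∧ w.Sublist b ∧
      a.length + b.length ≤ insdelDist a b + 2 * w.length := by
  have hne := exists_insDelStep_chain_of_reflTransGen (reflTransGen_insDelStep a b)
  obtain ⟨c, h0, hm, hc⟩ := Nat.sInf_mem
    (s := {m : ℕ | ∃ c : ℕ → List α, c 0 = a ∧ c m = b ∧ ∀ i < m, InsDelStep (c i) (c (i + 1))}) hne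
  have := exists_common_sublist_of_insDelStep_chain c _ hc
  rw [h0, hm] at this
  exact this

/-- A bound on the lengths of monotone matchings between distinct codewords bounds the minimum
insdel distance. -/
theorem le_codeInsdelDist {F : Type*} {n : ℕ} {C : Set (Fin n → F)} (hC : C.Nontrivial) (B : ℕ)
    (h : ∀ c₁ ∈ C, ∀ c₂ ∈ C, c₁ ≠ c₂ → ∀ (L : ℕ) (u v : Fin L → Fin n), StrictMono u →
      StrictMono v → (∀ k, c₁ (u k) = c₂ (v k)) → L ≤ B) :
    2 * n - 2 * B ≤ codeInsdelDist C := by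
  obtain ⟨d₁, hd₁, d₂, hd₂, hd⟩ := hC
  obtain ⟨c₁, h₁, c₂, h₂, hne, heq⟩ := Nat.sInf_mem
    (s := {m : ℕ | ∃ c1 ∈ C, ∃ c2 ∈ C, c1 ≠ c2 ∧ m = insdelDist (List.ofFn c1) (List.ofFn c2)})
    ⟨_, d₁, hd₁, d₂, hd₂, hd, rfl⟩
  change codeInsdelDist C = _ at heq
  rw [heq]
  obtain ⟨w, hw₁, hw₂, hlen⟩ := exists_common_sublist_insdelDist (List.ofFn c₁) (List.ofFn c₂)
  obtain ⟨f, hf⟩ := List.sublist_iff_exists_fin_orderEmbedding_get_eq.1 hw₁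
  obtain ⟨g, hg⟩ := List.sublist_iff_exists_fin_orderEmbedding_get_eq.1 hw₂
  have := h c₁ h₁ c₂ h₂ hne w.length (fun k => (f k).cast (List.length_ofFn))
    (fun k => (g k).cast (List.length_ofFn)) (fun _ _ hkl => f.strictMono hkl)
    (fun _ _ hkl => g.strictMono hkl) fun k => by
      have h1 := hf k
      have h2 := hg k
      rw [List.get_ofFn] at h1 h2
      exact h1.symm.trans h2
  simp only [List.length_ofFn] at hlen
  omega

/-- The elements of `F` fixed by the `d`-th iterate of the Frobenius. -/
def frobeniusFixed (F : Type*) [Field F] (p : ℕ) [ExpChar F p] (d : ℕ) : Subfield F :=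
  (iterateFrobenius F p d).eqLocusField (RingHom.id F)

section Algebra

variable {F : Type*} [Field F] {p : ℕ} [ExpChar F p]

theorem mem_frobeniusFixed_iff_pow {d : ℕ} {x : F} :
    x ∈ frobeniusFixed F p d ↔ x ^ p ^ d = x := Iff.rfl

theorem mem_frobeniusFixed_iff {d : ℕ} {x : F} :
    x ∈ frobeniusFixed F p d ↔ IsPeriodicPt (frobenius F p) d x := by
  rw [mem_frobeniusFixed_iff_pow, IsPeriodicPt, IsFixedPt, iterate_frobenius]

theorem frobeniusFixed_mono {d e : ℕ} (h : d ∣ e) :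
    frobeniusFixed F p d ≤ frobeniusFixed F p e := fun _ hx =>
  mem_frobeniusFixed_iff.2 ((mem_frobeniusFixed_iff.1 hx).trans_dvd h)

theorem mem_frobeniusFixed_of_gcd_dvd {d e g : ℕ} {x : F} (hd : x ∈ frobeniusFixed F p d)
    (he : x ∈ frobeniusFixed F p e) (h : d.gcd e ∣ g) : x ∈ frobeniusFixed F p g :=
  frobeniusFixed_mono h (mem_frobeniusFixed_iff.2
    ((mem_frobeniusFixed_iff.1 hd).gcd (mem_frobeniusFixed_iff.1 he)))

/-- An affine map sending two distinct points of a subfield into it has coefficients there. -/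
theorem affine_coeff_mem {K : Subfield F} {m c x x' y y' : F} (hx : x ∈ K) (hx' : x' ∈ K)
    (hy : y ∈ K) (hy' : y' ∈ K) (hne : x ≠ x') (h : y = m * x + c) (h' : y' = m * x' + c) :
    m ∈ K ∧ c ∈ K := by
  have hm : m = (y - y') / (x - x') := by
    rw [eq_div_iff (sub_ne_zero.2 hne), h, h']; ring
  have hmK : m ∈ K := hm ▸ K.div_mem (K.sub_mem hy hy') (K.sub_mem hx hx')
  have hc : c = y - m * x := by rw [h]; ring
  exact ⟨hmK, hc ▸ K.sub_mem hy (K.mul_mem hmK hx)⟩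

/-- A family of blocks, the `i`-th lying in the subfield of degree `t i`, avoiding the prime field
and moved off itself by every nontrivial affine map over the prime field. -/
structure IsRigidFamily (p : ℕ) [ExpChar F p] {ι κ : Type*} (t : ι → ℕ) (A : ι → κ → F) :
    Prop where
  mem : ∀ i x, A i x ∈ frobeniusFixed F p (t i)
  notMem : ∀ i x, A i x ∉ frobeniusFixed F p 1
  injective : ∀ i, Injective (A i)
  rigid : ∀ i x y, ∀ m ∈ frobeniusFixed F p 1, ∀ c ∈ frobeniusFixed F p 1,
    A i y = m * A i x + c → m = 1 ∧ c = 0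

namespace IsRigidFamily

variable {ι κ : Type*} {t : ι → ℕ} {A : ι → κ → F}

theorem eq_of_apply_eq (hA : IsRigidFamily p t A) (hco : Pairwise (Nat.Coprime on t))
    {i j : ι} {x y : κ} (h : A i x = A j y) : i = j ∧ x = y := by
  by_cases hij : i = j
  · subst hij
    exact ⟨rfl, hA.injective i h⟩
  · exact absurd (mem_frobeniusFixed_of_gcd_dvd (hA.mem i x) (h ▸ hA.mem j y)
      (hco hij).dvd) (hA.notMem i x)

theorem false_of_coeff_mem (hA : IsRigidFamily p t A) (hco : Pairwise (Nat.Coprime on t))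
    {i j : ι} (hij : i ≠ j) {x y : κ} {m c : F} (hm0 : m ≠ 0) (h : A j y = m * A i x + c)
    {r : ι} (hr : r = i ∨ r = j) (hm : m ∈ frobeniusFixed F p (t r))
    (hc : c ∈ frobeniusFixed F p (t r)) : False := by
  rcases hr with rfl | rfl
  · refine hA.notMem j y (mem_frobeniusFixed_of_gcd_dvd (e := t r) (hA.mem j y) ?_
      (hco hij.symm).dvd)
    rw [h]
    exact add_mem (mul_mem hm (hA.mem r x)) hc
  · refine hA.notMem i x (mem_frobeniusFixed_of_gcd_dvd (e := t r) (hA.mem i x) ?_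
      (hco hij).dvd)
    have : A i x = (A r y - c) / m := by rw [h]; field_simp; ring
    rw [this]
    exact div_mem (sub_mem (hA.mem r y) hc) hm

theorem coeff_mem (hA : IsRigidFamily p t A) {i j : ι} {x x' y y' : κ} {m c : F}
    (hne : x ≠ x') (h : A j y = m * A i x + c) (h' : A j y' = m * A i x' + c) {d : ℕ}
    (hi : t i ∣ d) (hj : t j ∣ d) :
    m ∈ frobeniusFixed F p d ∧ c ∈ frobeniusFixed F p d :=
  affine_coeff_mem (frobeniusFixed_mono hi (hA.mem i x)) (frobeniusFixed_mono hi (hA.mem i x'))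
    (frobeniusFixed_mono hj (hA.mem j y)) (frobeniusFixed_mono hj (hA.mem j y'))
    ((hA.injective i).ne hne) h h'

theorem eq_or_eq_swap_of_ne (hA : IsRigidFamily p t A) (hco : Pairwise (Nat.Coprime on t))
    {i j k l : ι} {x x' y y' z z' w w' : κ} {m c : F} (hm0 : m ≠ 0)
    (hx : x ≠ x') (h : A j y = m * A i x + c) (h' : A j y' = m * A i x' + c)
    (hz : z ≠ z') (g : A l w = m * A k z + c) (g' : A l w' = m * A k z' + c) (hij : i ≠ j) :
    (k = i ∧ l = j) ∨ (k = j ∧ l = i) := by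
  obtain ⟨hm, hc⟩ := hA.coeff_mem hx h h' (dvd_mul_right (t i) (t j)) (dvd_mul_left _ _)
  obtain ⟨hm', hc'⟩ := hA.coeff_mem hz g g' (dvd_mul_right (t k) (t l)) (dvd_mul_left _ _)
  have hi : i = k ∨ i = l := by
    by_contra! hi
    have hd : (t i * t j).gcd (t k * t l) ∣ t j := by
      rw [Nat.Coprime.gcd_mul_left_cancel]
      · exact Nat.gcd_dvd_left _ _
      · exact Nat.Coprime.mul_right (hco hi.1) (hco hi.2)
    exact hA.false_of_coeff_mem hco hij hm0 h (.inr rfl) (mem_frobeniusFixed_of_gcd_dvd hm hm' hd)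
      (mem_frobeniusFixed_of_gcd_dvd hc hc' hd)
  have hj : j = k ∨ j = l := by
    by_contra! hj
    have hd : (t i * t j).gcd (t k * t l) ∣ t i := by
      rw [Nat.Coprime.gcd_mul_right_cancel]
      · exact Nat.gcd_dvd_left _ _
      · exact Nat.Coprime.mul_right (hco hj.1) (hco hj.2)
    exact hA.false_of_coeff_mem hco hij hm0 h (.inl rfl) (mem_frobeniusFixed_of_gcd_dvd hm hm' hd)
      (mem_frobeniusFixed_of_gcd_dvd hc hc' hd)
  grind

/-- A nontrivial affine map has, up to swapping source and target, at most one pair of blocks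
between which it matches at least two points. -/
theorem eq_or_eq_swap (hA : IsRigidFamily p t A) (hco : Pairwise (Nat.Coprime on t))
    {i j k l : ι} {x x' y y' z z' w w' : κ} {m c : F} (hm0 : m ≠ 0) (hmc : ¬ (m = 1 ∧ c = 0))
    (hx : x ≠ x') (h : A j y = m * A i x + c) (h' : A j y' = m * A i x' + c)
    (hz : z ≠ z') (g : A l w = m * A k z + c) (g' : A l w' = m * A k z' + c) :
    (k = i ∧ l = j) ∨ (k = j ∧ l = i) := by
  by_cases hij : i = j
  · by_cases hkl : k = l
    · subst hij hkl
      by_cases hik : k = i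
      · exact .inl ⟨hik, hik⟩
      obtain ⟨hm, hc⟩ := hA.coeff_mem hx h h' dvd_rfl dvd_rfl
      obtain ⟨hm', hc'⟩ := hA.coeff_mem hz g g' dvd_rfl dvd_rfl
      have hd := (hco hik).symm.dvd
      exact absurd (hA.rigid i x y m (mem_frobeniusFixed_of_gcd_dvd hm hm' hd) c
        (mem_frobeniusFixed_of_gcd_dvd hc hc' hd) h) hmc
    · have := hA.eq_or_eq_swap_of_ne hco hm0 hz g g' hx h h' hkl
      grind
  · exact hA.eq_or_eq_swap_of_ne hco hm0 hx h h' hz g g' hij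

end IsRigidFamily

end Algebra

theorem mem_frobeniusFixed_one_iff {F : Type*} [Field F] {p : ℕ} [Fact p.Prime] [CharP F p]
    [Algebra (ZMod p) F] {x : F} :
    x ∈ frobeniusFixed F p 1 ↔ ∃ a : ZMod p, algebraMap (ZMod p) F a = x := by
  rw [mem_frobeniusFixed_iff_pow, pow_one]
  constructor
  · intro h
    exact bot_le (a := (algebraMap (ZMod p) F).fieldRange)
      ((Subfield.mem_bot_iff_pow_eq_self F p).2 h)
  · rintro ⟨a, rfl⟩
    rw [← map_pow, ZMod.pow_card]

theorem exists_basis_zero_eq_one {p k : ℕ} [Fact p.Prime] :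
    ∃ b : Module.Basis (Fin (k + 2)) (ZMod p) (GaloisField p (k + 2)), b 0 = 1 := by
  have : Algebra.IsSeparable (ZMod p) (GaloisField p (k + 2)) :=
    Algebra.IsAlgebraic.isSeparable_of_perfectField
  let pb := Field.powerBasisOfFiniteOfSeparable (ZMod p) (GaloisField p (k + 2))
  have hdim : pb.dim = k + 2 := by
    rw [← pb.finrank, GaloisField.finrank p (by omega)]
  refine ⟨pb.basis.reindex (finCongr hdim), ?_⟩
  simp

theorem exists_rigid_block {F : Type*} [Field F] [Fintype F] {p T k N : ℕ} [hp : Fact p.Prime]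
    [CharP F p] (hq : Fintype.card F = p ^ T) (hk : k + 2 ∣ T) (hN : N ≤ p ^ k) :
    ∃ g : Fin N → F, Injective g ∧ (∀ x, g x ∈ frobeniusFixed F p (k + 2)) ∧
      (∀ x, g x ∉ frobeniusFixed F p 1) ∧
      ∀ x y, ∀ m ∈ frobeniusFixed F p 1, ∀ c ∈ frobeniusFixed F p 1,
        g y = m * g x + c → m = 1 ∧ c = 0 := by
  let _ : Algebra (ZMod p) F := ZMod.algebra F p
  have hfin : Module.finrank (ZMod p) F = T := by
    have := FiniteField.pow_finrank_eq_card p (k := F)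
    rw [hq] at this
    exact Nat.pow_right_injective hp.out.two_le this
  obtain ⟨e⟩ : Nonempty (GaloisField p (k + 2) →ₐ[ZMod p] F) :=
    FiniteField.nonempty_algHom_of_finrank_dvd (by
      rwa [GaloisField.finrank p (by omega), hfin])
  obtain ⟨b, hb⟩ := exists_basis_zero_eq_one (p := p) (k := k)
  obtain ⟨w⟩ : Nonempty (Fin N ↪ (Fin k → ZMod p)) :=
    Function.Embedding.nonempty_of_card_le (by simpa [ZMod.card] using hN)
  let v : Fin N → GaloisField p (k + 2) := fun x =>
    b.equivFun.symm (Fin.cons 0 (Fin.cons 1 (w x)))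
  have hv : ∀ x, b.equivFun (v x) = Fin.cons 0 (Fin.cons 1 (w x)) := fun x =>
    b.equivFun.apply_symm_apply _
  have hv0 : ∀ x, b.equivFun (v x) 0 = 0 := fun x => by rw [hv]; rfl
  have hv1 : ∀ x, b.equivFun (v x) 1 = 1 := fun x => by rw [hv]; rfl
  have hone : b.equivFun 1 = Pi.single 0 1 := by
    rw [← hb]; ext i; simp [Pi.single_apply, eq_comm]
  have hrel : ∀ y, ∀ z : GaloisField p (k + 2), ∀ m c : ZMod p,
      e (v y) = algebraMap _ F m * e z + algebraMap _ F c →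
      b.equivFun (v y) = m • b.equivFun z + c • Pi.single 0 1 := by
    intro y z m c h
    have : v y = m • z + c • 1 := e.toRingHom.injective (by
      change e (v y) = e (m • z + c • 1)
      rw [h]; simp [Algebra.smul_def])
    rw [this, map_add, map_smul, map_smul, hone]
  refine ⟨fun x => e (v x), ?_, ?_, ?_, ?_⟩
  · intro x y h
    have h := b.equivFun.symm.injective (e.toRingHom.injective h)
    exact w.injective (Fin.cons_right_injective _ (Fin.cons_right_injective _ h))
  · intro x
    rw [mem_frobeniusFixed_iff_pow, ← map_pow]
    congr 1
    have := Fintype.ofFinite (GaloisField p (k + 2))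
    have hc := FiniteField.pow_card (v x)
    rwa [Fintype.card_eq_nat_card, GaloisField.card p _ (by omega)] at hc
  · intro x hx
    obtain ⟨c, hc⟩ := mem_frobeniusFixed_one_iff.1 hx
    have := congrFun (hrel x 0 0 c (by simp [hc])) 1
    simp [hv1] at this
  · intro x y m hm c hc h
    obtain ⟨m, rfl⟩ := mem_frobeniusFixed_one_iff.1 hm
    obtain ⟨c, rfl⟩ := mem_frobeniusFixed_one_iff.1 hc
    have h := hrel y (v x) m c h
    have h0 := congrFun h 0
    have h1 := congrFun h 1
    simp [hv0, hv1, -Module.Basis.equivFun_apply] at h0 h1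
    simp [← h0, ← h1]

/-- A monotone path through an `M × M` grid of blocks, whose rows and columns each hold at most `N`
points and whose crowded blocks all lie on one antidiagonal, has at most `N + (2 * M - 3)`
points. -/
theorem length_le_of_monotone_path {M N L : ℕ} (hM : 2 ≤ M) {f g : Fin L → ℕ} (hf : Monotone f)
    (hg : Monotone g) (hfM : ∀ k, f k < M) (hgM : ∀ k, g k < M)
    (hrow : ∀ r, (Finset.univ.filter fun k => f k = r).card ≤ N)
    (hcol : ∀ r, (Finset.univ.filter fun k => g k = r).card ≤ N)
    (hbig : ∀ k k' l l', k ≠ k' → f k = f k' → g k = g k' → l ≠ l' → f l = f l' → g l = g l' →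
      f k + g k = f l + g l) :
    L ≤ N + (2 * M - 3) := by
  have hdiag : ∀ k l, f k + g k = f l + g l → f k = f l ∧ g k = g l := by
    intro k l h
    rcases le_total k l with hkl | hkl <;>
    · have := hf hkl
      have := hg hkl
      omega
  have hnext : ∀ k l, f k + g k + 1 = f l + g l → f k = f l ∨ g k = g l := by
    intro k l h
    rcases le_total k l with hkl | hkl <;>
    · have := hf hkl
      have := hg hkl
      omega
  let D : ℕ → Finset (Fin L) := fun a => Finset.univ.filter fun k => f k + g k = a
  have hD : ∀ a k, k ∈ D a ↔ f k + g k = a := by simp [D]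
  have hadj : ∀ a, (D a).card + (D (a + 1)).card ≤ N := by
    intro a
    have hdisj : Disjoint (D a) (D (a + 1)) :=
      Finset.disjoint_left.2 fun k h h' => by rw [hD] at h h'; omega
    rw [← Finset.card_union_of_disjoint hdisj]
    suffices h : (∃ r, ∀ k ∈ D a ∪ D (a + 1), f k = r) ∨
        ∃ r, ∀ k ∈ D a ∪ D (a + 1), g k = r by
      rcases h with ⟨r, h⟩ | ⟨r, h⟩
      · exact (Finset.card_le_card fun k hk => by simpa using h k hk).trans (hrow r)
      · exact (Finset.card_le_card fun k hk => by simpa using h k hk).trans (hcol r)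
    simp only [Finset.mem_union, hD]
    by_cases h0 : ∃ k, f k + g k = a
    · obtain ⟨k, hk⟩ := h0
      by_cases h1 : ∃ l, f l + g l = a + 1
      · obtain ⟨l, hl⟩ := h1
        rcases hnext k l (by omega) with h | h
        · refine .inl ⟨f k, fun i hi => ?_⟩
          rcases hi with hi | hi
          · exact (hdiag i k (by omega)).1
          · exact (hdiag i l (by omega)).1.trans h.symm
        · refine .inr ⟨g k, fun i hi => ?_⟩
          rcases hi with hi | hi
          · exact (hdiag i k (by omega)).2
          · exact (hdiag i l (by omega)).2.trans h.symm
      · exact .inl ⟨f k, fun i hi => hi.elim (fun hi => (hdiag i k (by omega)).1)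
          fun hi => (h1 ⟨i, hi⟩).elim⟩
    · by_cases h1 : ∃ l, f l + g l = a + 1
      · obtain ⟨l, hl⟩ := h1
        exact .inl ⟨f l, fun i hi => hi.elim (fun hi => (h0 ⟨i, hi⟩).elim)
          fun hi => (hdiag i l (by omega)).1⟩
      · exact .inl ⟨0, fun i hi => hi.elim (fun hi => (h0 ⟨i, hi⟩).elim)
          fun hi => (h1 ⟨i, hi⟩).elim⟩
  have hcrowded : ∀ a b, 1 < (D a).card → 1 < (D b).card → a = b := by
    intro a b ha hb
    obtain ⟨k, hk, k', hk', hkk⟩ := Finset.one_lt_card.1 ha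
    obtain ⟨l, hl, l', hl', hll⟩ := Finset.one_lt_card.1 hb
    rw [hD] at hk hk' hl hl'
    have h := hdiag k k' (by omega)
    have h' := hdiag l l' (by omega)
    rw [← hk, ← hl]
    exact hbig k k' l l' hkk h.1 h.2 hll h'.1 h'.2
  obtain ⟨b, hb, hrest⟩ : ∃ b, b + 1 < 2 * M - 1 ∧
      ∀ a, a ≠ b → a ≠ b + 1 → (D a).card ≤ 1 := by
    by_cases h : ∃ a, 1 < (D a).card
    · obtain ⟨a, ha⟩ := h
      have haM : a < 2 * M - 1 := by
        obtain ⟨k, hk⟩ := Finset.card_pos.1 (by omega : 0 < (D a).card)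
        rw [hD] at hk
        have := hfM k
        have := hgM k
        omega
      refine ⟨if a = 0 then 0 else a - 1, by split_ifs <;> omega, fun c hc hc' => ?_⟩
      by_contra! hcard
      have := hcrowded c a hcard ha
      split_ifs at hc hc' <;> omega
    · push Not at h
      exact ⟨0, by omega, fun a _ _ => h a⟩
  have hsum : L = ∑ a ∈ Finset.range (2 * M - 1), (D a).card := by
    rw [← Finset.card_eq_sum_card_fiberwise (f := fun k => f k + g k) (s := Finset.univ),
      Finset.card_univ, Fintype.card_fin]
    intro k _
    have := hfM k
    have := hgM k
    simp only [Finset.coe_range, Set.mem_Iio]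
    omega
  have hsub : {b, b + 1} ⊆ Finset.range (2 * M - 1) := by
    intro a ha
    simp only [Finset.mem_insert, Finset.mem_singleton] at ha
    simp only [Finset.mem_range]
    omega
  have hpair : ({b, b + 1} : Finset ℕ).card = 2 := Finset.card_pair (by omega)
  calc L = ∑ a ∈ {b, b + 1}, (D a).card +
        ∑ a ∈ Finset.range (2 * M - 1) \ {b, b + 1}, (D a).card := by
        rw [add_comm, Finset.sum_sdiff hsub, hsum.symm]
    _ ≤ N + ∑ a ∈ Finset.range (2 * M - 1) \ {b, b + 1}, 1 := by
        refine add_le_add ?_ (Finset.sum_le_sum fun a ha => ?_)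
        · rw [Finset.sum_pair (by omega)]
          exact hadj b
        · simp only [Finset.mem_sdiff, Finset.mem_insert, Finset.mem_singleton, not_or] at ha
          exact hrest a ha.2.1 ha.2.2
    _ = N + (2 * M - 3) := by
        rw [Finset.sum_const, smul_eq_mul, mul_one, Finset.card_sdiff_of_subset hsub, hpair,
          Finset.card_range]
        omega

theorem divNat_modNat_injective {M N : ℕ} {x y : Fin (M * N)} (h : x.divNat = y.divNat)
    (h' : x.modNat = y.modNat) : x = y :=
  finProdFinEquiv.symm.injective (Prod.ext h h')

theorem card_divNat_fiber_le {M N L : ℕ} {u : Fin L → Fin (M * N)} (hu : Injective u) (r : ℕ) :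
    (Finset.univ.filter fun k => ((u k).divNat : ℕ) = r).card ≤ N := by
  refine (Finset.card_le_card_of_injOn (t := Finset.univ) (fun k => (u k).modNat) (by simp)
    ?_).trans_eq (Finset.card_fin N)
  intro k hk l hl h
  simp only [Finset.coe_filter, Finset.mem_univ, true_and, Set.mem_ofPred_eq] at hk hl
  exact hu (divNat_modNat_injective (Fin.ext (hk.trans hl.symm)) h)

theorem monotone_divNat {M N L : ℕ} {u : Fin L → Fin (M * N)} (hu : StrictMono u) :
    Monotone fun k => ((u k).divNat : ℕ) := fun _ _ h =>
  Nat.div_le_div_right (hu.monotone h)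

namespace IsRigidFamily

variable {F : Type*} [Field F] {p : ℕ} [ExpChar F p] {M N : ℕ} {t : Fin M → ℕ}
  {A : Fin M → Fin N → F}

theorem injective_concat (hA : IsRigidFamily p t A) (hco : Pairwise (Nat.Coprime on t)) :
    Injective fun i : Fin (M * N) => A i.divNat i.modNat := fun _ _ h =>
  have h := hA.eq_of_apply_eq hco h
  divNat_modNat_injective h.1 h.2

theorem length_le_of_affine_matching (hA : IsRigidFamily p t A)
    (hco : Pairwise (Nat.Coprime on t)) (hM : 2 ≤ M) {m c : F} (hm0 : m ≠ 0)
    (hmc : ¬ (m = 1 ∧ c = 0)) {L : ℕ} {u v : Fin L → Fin (M * N)} (hu : StrictMono u)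
    (hv : StrictMono v)
    (h : ∀ k, A (v k).divNat (v k).modNat = m * A (u k).divNat (u k).modNat + c) :
    L ≤ N + (2 * M - 3) := by
  refine length_le_of_monotone_path hM (monotone_divNat hu) (monotone_divNat hv)
    (fun k => (u k).divNat.isLt) (fun k => (v k).divNat.isLt)
    (card_divNat_fiber_le hu.injective) (card_divNat_fiber_le hv.injective) ?_
  intro k k' l l' hk hfk hgk hl hfl hgl
  replace hfk := Fin.ext hfk
  replace hgk := Fin.ext hgk
  replace hfl := Fin.ext hfl
  replace hgl := Fin.ext hgl
  have hk' := h k'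
  have hl' := h l'
  rw [← hfk, ← hgk] at hk'
  rw [← hfl, ← hgl] at hl'
  rcases hA.eq_or_eq_swap hco hm0 hmc
    (fun hx => hk (hu.injective (divNat_modNat_injective hfk hx))) (h k) hk'
    (fun hx => hl (hu.injective (divNat_modNat_injective hfl hx))) (h l) hl' with e | e
  · rw [e.1, e.2]
  · rw [e.1, e.2, add_comm]

theorem le_codeInsdelDist (hA : IsRigidFamily p t A) (hco : Pairwise (Nat.Coprime on t))
    (hM : 2 ≤ M) (hN : 1 ≤ N) :
    2 * (M * N) - 2 * (N + (2 * M - 3)) ≤ codeInsdelDist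
      {w : Fin (M * N) → F | ∃ a b : F, w = fun i => a * A i.divNat i.modNat + b} := by
  have hpos : 0 < M * N := by positivity
  have hinj := hA.injective_concat hco
  apply _root_.le_codeInsdelDist
  · refine ⟨fun _ => 0, ⟨0, 0, by simp⟩, fun _ => 1, ⟨0, 1, by simp⟩, fun h => ?_⟩
    exact zero_ne_one (congrFun h ⟨0, hpos⟩)
  rintro _ ⟨a, b, rfl⟩ _ ⟨a', b', rfl⟩ hne L u v hu hv h
  simp only at h
  by_cases h0 : a ≠ 0 ∧ a' ≠ 0
  · obtain ⟨ha, ha'⟩ := h0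
    refine hA.length_le_of_affine_matching hco hM (m := a / a') (c := (b - b') / a')
      (div_ne_zero ha ha') ?_ hu hv fun k => ?_
    · rintro ⟨h1, h2⟩
      rw [div_eq_one_iff_eq ha'] at h1
      have h2 : b = b' := by
        rcases div_eq_zero_iff.1 h2 with h2 | h2
        · exact sub_eq_zero.1 h2
        · exact absurd h2 ha'
      exact hne (by rw [h1, h2])
    · have := h k
      field_simp
      linear_combination -this
  · suffices hL : L ≤ 1 by omega
    by_contra! hL
    have hkl : (⟨0, by omega⟩ : Fin L) ≠ ⟨1, hL⟩ := by simp
    have e0 := h ⟨0, by omega⟩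
    have e1 := h ⟨1, hL⟩
    by_cases ha : a = 0
    · by_cases ha' : a' = 0
      · apply hne
        have hb : b = b' := by simpa [ha, ha'] using e0
        rw [ha, ha', hb]
      · refine hkl (hv.injective (hinj (mul_left_cancel₀ ha' ?_)))
        rw [ha] at e0 e1
        linear_combination e1 - e0
    · refine hkl (hu.injective (hinj (mul_left_cancel₀ ha ?_)))
      rw [show a' = 0 by tauto] at e0 e1
      linear_combination e0 - e1

end IsRigidFamily

theorem two_mul_two_pow_sub_three_le {p s : ℕ} (hp : 1 ≤ p) (hs : 1 ≤ s) :
    2 * 2 ^ s - 3 ≤ ∑ i ∈ Finset.range s, (2 ^ i * (2 ^ i - 1) * p + 2 ^ i) := by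
  induction s, hs using Nat.le_induction with
  | base => simp
  | succ s hs ih =>
    rw [Finset.sum_range_succ]
    have h2 : 2 ≤ 2 ^ s := Nat.le_self_pow (by omega) 2
    have : 2 ^ s ≤ 2 ^ s * (2 ^ s - 1) * p := by
      rw [mul_assoc]
      exact Nat.le_mul_of_pos_right _ (Nat.mul_pos (by omega) hp)
    rw [pow_succ]
    omega

/-- for a prime `p`, `s ≥ 1`, pairwise coprime `t 0 < ⋯ < t (2^s - 1)` with
`t 0 ≥ 5` and `q = p^(t 0 ⋯ t (2^s - 1))`, there exists a 2-dimensional Reed–Solomon code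
over `F_q` of length `n = 2^s p^(t 0 - 2)` with minimum insdel distance at least
`2n - 2(n/2^s + ∑_{i=0}^{s-1} (2^i(2^i-1)p + 2^i))`. -/
theorem exists_rs_code_insdel_distance_asymptotic
    {F : Type*} [Field F] [Fintype F] (p s : ℕ) (hp : p.Prime) (hs : 1 ≤ s)
    (t : Fin (2 ^ s) → ℕ)
    (hmono : StrictMono t)
    (ht1 : 5 ≤ t ⟨0, by positivity⟩)
    (hco : Pairwise (Nat.Coprime on t))
    (hq : Fintype.card F = p ^ (∏ i, t i)) :
    ∀ n : ℕ, n = 2 ^ s * p ^ (t ⟨0, by positivity⟩ - 2) →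
      ∃ α : Fin n → F, Function.Injective α ∧
        2 * n - 2 * (n / 2 ^ s + ∑ i ∈ Finset.range s, (2 ^ i * (2 ^ i - 1) * p + 2 ^ i)) ≤
          codeInsdelDist {c | ∃ a b : F, c = fun i => a * α i + b} := by
  have := Fact.mk hp
  have : CharP F p := charP_of_card_eq_prime_pow hq
  rintro n rfl
  set N := p ^ (t ⟨0, by positivity⟩ - 2)
  have ht : ∀ i, t ⟨0, by positivity⟩ ≤ t i := fun i => hmono.monotone (Nat.zero_le _)
  have hblock := fun i => exists_rigid_block (k := t i - 2) (N := N) hq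
    (by rw [Nat.sub_add_cancel (by have := ht i; omega)]; exact Finset.dvd_prod_of_mem t (by simp))
    (Nat.pow_le_pow_right hp.pos (by have := ht i; omega))
  choose A hinj hmem hnotMem hrigid using hblock
  have hA : IsRigidFamily p t A := by
    refine ⟨fun i x => ?_, hnotMem, hinj, hrigid⟩
    have := hmem i x
    rwa [Nat.sub_add_cancel (by have := ht i; omega)] at this
  refine ⟨fun i => A i.divNat i.modNat, hA.injective_concat hco, ?_⟩
  refine le_trans ?_ (hA.le_codeInsdelDist hco (Nat.le_self_pow (by omega) 2)
    (Nat.pow_pos hp.pos))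
  have := two_mul_two_pow_sub_three_le hp.one_le hs
  rw [Nat.mul_div_cancel_left _ (by positivity)]
  omega
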